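/- For any two policies π and π' and any function Q : X × A → [0, H], the difference of expectations under their occupancy measures satisfies ⟨μ^{π'}, Q⟩ − ⟨μ^{π}, Q⟩ ≤ √( 2 H³ · H(π' ‖ π) ), where ⟨μ, Q⟩ = Σ_{x,a} μ(x,a) Q(x,a). -/

import Mathlib

open scoped ENNReal

/-- The state distribution of the Markov chain induced by policy `π`:
`stateDist P ν₀ π t x = Pr_π[X_t = x]`. -/
noncomputable def stateDist {X A : Type*} [Fintype X] [Fintype A]
    (P : X → A → X → ℝ) (ν₀ : X → ℝ) (π : X → A → ℝ) : ℕ → X → ℝ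
  | 0 => ν₀
  | t + 1 => fun x' => ∑ x, ∑ a, stateDist P ν₀ π t x * π x a * P x a x'

/-- The normalized discounted state-action occupancy measure
`μ^π(x,a) = (1−γ) Σ_{t≥0} γ^t Pr_π[X_t = x, A_t = a]`. -/
noncomputable def occ {X A : Type*} [Fintype X] [Fintype A]
    (γ : ℝ) (P : X → A → X → ℝ) (ν₀ : X → ℝ) (π : X → A → ℝ) (x : X) (a : A) : ℝ :=
  (1 - γ) * ∑' t : ℕ, γ ^ t * stateDist P ν₀ π t x * π x a

open Classical in
/-- Relative entropy between two (finitely supported) distributions given as functions,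
valued in `[0,∞]`, with `KL(p‖q) = ∞` when `p` is not absolutely continuous w.r.t. `q`. -/
noncomputable def KLd {S : Type*} [Fintype S] (p q : S → ℝ) : ℝ≥0∞ :=
  if ∀ s, q s = 0 → p s = 0 then
    ENNReal.ofReal (∑ s, if p s = 0 then (0 : ℝ) else p s * Real.log (p s / q s))
  else ⊤

/-- The conditional relative entropy `H(π‖π') = Σ_x ν^π(x) KL(π(·|x) ‖ π'(·|x))`, where
`ν^π(x) = Σ_a μ^π(x,a)` is the discounted state occupancy of `π`. -/
noncomputable def condKL {X A : Type*} [Fintype X] [Fintype A]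
    (γ : ℝ) (P : X → A → X → ℝ) (ν₀ : X → ℝ) (π π' : X → A → ℝ) : ℝ≥0∞ :=
  ∑ x, ENNReal.ofReal (∑ a, occ γ P ν₀ π x a) * KLd (π x) (π' x)

open Finset

section Entropy

/-- Tangent-line lower bound for `u ↦ u log (u / v)`. -/
lemma mul_log_add_sub_le_mul_log_div {u v c : ℝ} (hu : 0 ≤ u) (hv : 0 ≤ v) (hvu : v = 0 → u = 0)
    (hc : 0 < c) : u * Real.log c + u - c * v ≤ u * Real.log (u / v) := by
  rcases hu.eq_or_lt with rfl | hu
  · simpa using mul_nonneg hc.le hv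
  · have hv : 0 < v := hv.lt_of_ne fun h => hu.ne' (hvu h.symm)
    have hlog := Real.log_le_sub_one_of_pos (show 0 < c * v / u by positivity)
    rw [Real.log_div (by positivity) hu.ne', Real.log_mul hc.ne' hv.ne'] at hlog
    rw [Real.log_div hu.ne' hv.ne']
    have hmul := mul_le_mul_of_nonneg_left hlog hu.le
    have hcancel : u * (c * v / u - 1) = c * v - u := by field_simp
    linarith

lemma sum_mul_log_div_nonneg {S : Type*} [Fintype S] {p q : S → ℝ} (hp : ∀ s, 0 ≤ p s)
    (hq : ∀ s, 0 ≤ q s) (hpq : ∀ s, q s = 0 → p s = 0) (hsum : ∑ s, p s = ∑ s, q s) :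
    0 ≤ ∑ s, p s * Real.log (p s / q s) := by
  have h := sum_le_sum fun s (_ : s ∈ univ) =>
    mul_log_add_sub_le_mul_log_div (hp s) (hq s) (hpq s) one_pos
  simpa [hsum] using h

/-- Relative entropy dominates the squared Hellinger distance, pointwise form. -/
lemma sq_sqrt_sub_sqrt_add_sub_le_mul_log_div {u v : ℝ} (hu : 0 ≤ u) (hv : 0 ≤ v)
    (hvu : v = 0 → u = 0) : (√u - √v) ^ 2 + u - v ≤ u * Real.log (u / v) := by
  rcases hu.eq_or_lt with rfl | hu
  · simp [Real.sq_sqrt hv]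
  · have hv : 0 < v := hv.lt_of_ne fun h => hu.ne' (hvu h.symm)
    have hlog := Real.log_le_sub_one_of_pos (show 0 < √v / √u by positivity)
    rw [Real.log_div (by positivity) (by positivity), Real.log_sqrt hv.le,
      Real.log_sqrt hu.le] at hlog
    rw [Real.log_div hu.ne' hv.ne']
    have hmul := mul_le_mul_of_nonneg_left hlog hu.le
    have hcancel : u * (√v / √u - 1) = √u * √v - u := by
      have := Real.sqrt_pos.2 hu
      field_simp
      linear_combination -√v * Real.sq_sqrt hu.le
    nlinarith [Real.sq_sqrt hu.le, Real.sq_sqrt hv.le]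

/-- A Pinsker-type inequality for expectations of bounded functions. -/
lemma sq_sum_sub_mul_le_sum_mul_log_div {S : Type*} [Fintype S] {p q f : S → ℝ} {M : ℝ}
    (hp : ∀ s, 0 ≤ p s) (hq : ∀ s, 0 ≤ q s) (hpq : ∀ s, q s = 0 → p s = 0)
    (hp1 : ∑ s, p s = 1) (hq1 : ∑ s, q s = 1) (hf0 : ∀ s, 0 ≤ f s) (hfM : ∀ s, f s ≤ M) :
    (∑ s, (p s - q s) * f s) ^ 2 ≤ M ^ 2 * ∑ s, p s * Real.log (p s / q s) := by
  have hkl : ∑ s, (√(p s) - √(q s)) ^ 2 ≤ ∑ s, p s * Real.log (p s / q s) := by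
    have h := sum_le_sum fun s (_ : s ∈ univ) =>
      sq_sqrt_sub_sqrt_add_sub_le_mul_log_div (hp s) (hq s) (hpq s)
    simpa [sum_sub_distrib, sum_add_distrib, hp1, hq1] using h
  have hcenter : ∑ s, (p s - q s) * f s
      = ∑ s, (√(p s) - √(q s)) * ((√(p s) + √(q s)) * (f s - M / 2)) := by
    have hzero : ∑ s, (p s - q s) * (M / 2) = 0 := by
      rw [← sum_mul, sum_sub_distrib, hp1, hq1]; ring
    rw [← sub_zero (∑ s, (p s - q s) * f s), ← hzero, ← sum_sub_distrib]
    refine sum_congr rfl fun s _ => ?_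
    linear_combination (-(f s - M / 2)) * (Real.sq_sqrt (hp s) - Real.sq_sqrt (hq s))
  have hweight : ∑ s, ((√(p s) + √(q s)) * (f s - M / 2)) ^ 2 ≤ M ^ 2 := by
    calc ∑ s, ((√(p s) + √(q s)) * (f s - M / 2)) ^ 2
        ≤ ∑ s, (2 * (p s + q s)) * (M ^ 2 / 4) := by
          refine sum_le_sum fun s _ => ?_
          rw [mul_pow]
          refine mul_le_mul ?_ ?_ (sq_nonneg _) (by linarith [hp s, hq s])
          · nlinarith [sq_nonneg (√(p s) - √(q s)), Real.sq_sqrt (hp s), Real.sq_sqrt (hq s)]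
          · nlinarith [mul_nonneg (hf0 s) (sub_nonneg.2 (hfM s))]
      _ = M ^ 2 := by
          rw [← sum_mul, ← mul_sum, sum_add_distrib, hp1, hq1]; ring
  rw [hcenter]
  calc _ ≤ (∑ s, (√(p s) - √(q s)) ^ 2) * ∑ s, ((√(p s) + √(q s)) * (f s - M / 2)) ^ 2 :=
        sum_mul_sq_le_sq_mul_sq _ _ _
    _ ≤ (∑ s, p s * Real.log (p s / q s)) * M ^ 2 :=
        mul_le_mul hkl hweight (sum_nonneg fun _ _ => sq_nonneg _)
          ((sum_nonneg fun _ _ => sq_nonneg _).trans hkl)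
    _ = _ := mul_comm _ _

lemma KLd_of_forall {S : Type*} [Fintype S] {p q : S → ℝ} (h : ∀ s, q s = 0 → p s = 0) :
    KLd p q = ENNReal.ofReal (∑ s, p s * Real.log (p s / q s)) := by
  rw [KLd, if_pos h]
  congr 1
  refine sum_congr rfl fun s _ => ?_
  split_ifs with hs <;> simp [hs]

end Entropy

section Occupancy

variable {X A : Type*} [Fintype X] [Fintype A]

lemma stateDist_nonneg {P : X → A → X → ℝ} (hP0 : ∀ x a x', 0 ≤ P x a x') {ν₀ : X → ℝ}
    (hν0 : ∀ x, 0 ≤ ν₀ x) {π : X → A → ℝ} (hπ0 : ∀ x a, 0 ≤ π x a) (t : ℕ) (x : X) :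
    0 ≤ stateDist P ν₀ π t x := by
  induction t generalizing x with
  | zero => exact hν0 x
  | succ t ih =>
    exact sum_nonneg fun y _ => sum_nonneg fun a _ =>
      mul_nonneg (mul_nonneg (ih y) (hπ0 y a)) (hP0 y a x)

lemma sum_stateDist {P : X → A → X → ℝ} (hP1 : ∀ x a, ∑ x', P x a x' = 1) {ν₀ : X → ℝ}
    (hν1 : ∑ x, ν₀ x = 1) {π : X → A → ℝ} (hπ1 : ∀ x, ∑ a, π x a = 1) (t : ℕ) :
    ∑ x, stateDist P ν₀ π t x = 1 := by
  induction t with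
  | zero => exact hν1
  | succ t ih =>
    simp only [stateDist]
    rw [sum_comm]
    calc _ = ∑ y, stateDist P ν₀ π t y := by
          refine sum_congr rfl fun y _ => ?_
          rw [sum_comm]
          simp only [← mul_sum, hP1, hπ1, mul_one]
      _ = 1 := ih

/-- The normalized discounted state occupancy measure. -/
noncomputable def stateOcc (γ : ℝ) (P : X → A → X → ℝ) (ν₀ : X → ℝ) (π : X → A → ℝ) (x : X) : ℝ :=
  (1 - γ) * ∑' t : ℕ, γ ^ t * stateDist P ν₀ π t x

lemma occ_eq_stateOcc_mul (γ : ℝ) (P : X → A → X → ℝ) (ν₀ : X → ℝ) (π : X → A → ℝ) (x : X)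
    (a : A) : occ γ P ν₀ π x a = stateOcc γ P ν₀ π x * π x a := by
  rw [occ, stateOcc, tsum_mul_right, mul_assoc]

lemma stateOcc_nonneg {γ : ℝ} (hγ0 : 0 < γ) (hγ1 : γ < 1) {P : X → A → X → ℝ}
    (hP0 : ∀ x a x', 0 ≤ P x a x') {ν₀ : X → ℝ} (hν0 : ∀ x, 0 ≤ ν₀ x) {π : X → A → ℝ}
    (hπ0 : ∀ x a, 0 ≤ π x a) (x : X) : 0 ≤ stateOcc γ P ν₀ π x :=
  mul_nonneg (by linarith) (tsum_nonneg fun t =>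
    mul_nonneg (by positivity) (stateDist_nonneg hP0 hν0 hπ0 t x))

lemma summable_discounted_stateDist {γ : ℝ} (hγ0 : 0 < γ) (hγ1 : γ < 1) {P : X → A → X → ℝ}
    (hP0 : ∀ x a x', 0 ≤ P x a x') (hP1 : ∀ x a, ∑ x', P x a x' = 1)
    {ν₀ : X → ℝ} (hν0 : ∀ x, 0 ≤ ν₀ x) (hν1 : ∑ x, ν₀ x = 1)
    {π : X → A → ℝ} (hπ0 : ∀ x a, 0 ≤ π x a) (hπ1 : ∀ x, ∑ a, π x a = 1) (x : X) :
    Summable fun t : ℕ => γ ^ t * stateDist P ν₀ π t x := by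
  refine Summable.of_nonneg_of_le
    (fun t => mul_nonneg (by positivity) (stateDist_nonneg hP0 hν0 hπ0 t x)) (fun t => ?_)
    (summable_geometric_of_lt_one hγ0.le hγ1)
  refine mul_le_of_le_one_right (by positivity) ?_
  rw [← sum_stateDist hP1 hν1 hπ1 t]
  exact single_le_sum (fun y _ => stateDist_nonneg hP0 hν0 hπ0 t y) (mem_univ x)

lemma sum_stateOcc {γ : ℝ} (hγ0 : 0 < γ) (hγ1 : γ < 1) {P : X → A → X → ℝ}
    (hP0 : ∀ x a x', 0 ≤ P x a x') (hP1 : ∀ x a, ∑ x', P x a x' = 1)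
    {ν₀ : X → ℝ} (hν0 : ∀ x, 0 ≤ ν₀ x) (hν1 : ∑ x, ν₀ x = 1)
    {π : X → A → ℝ} (hπ0 : ∀ x a, 0 ≤ π x a) (hπ1 : ∀ x, ∑ a, π x a = 1) :
    ∑ x, stateOcc γ P ν₀ π x = 1 := by
  simp only [stateOcc]
  rw [← mul_sum, ← Summable.tsum_finsetSum fun x _ =>
    summable_discounted_stateDist hγ0 hγ1 hP0 hP1 hν0 hν1 hπ0 hπ1 x]
  simp only [← mul_sum, sum_stateDist hP1 hν1 hπ1, mul_one]
  rw [tsum_geometric_of_lt_one hγ0.le hγ1]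
  exact mul_inv_cancel₀ (by linarith)

/-- The Bellman flow equation. -/
lemma stateOcc_eq {γ : ℝ} (hγ0 : 0 < γ) (hγ1 : γ < 1) {P : X → A → X → ℝ}
    (hP0 : ∀ x a x', 0 ≤ P x a x') (hP1 : ∀ x a, ∑ x', P x a x' = 1)
    {ν₀ : X → ℝ} (hν0 : ∀ x, 0 ≤ ν₀ x) (hν1 : ∑ x, ν₀ x = 1)
    {π : X → A → ℝ} (hπ0 : ∀ x a, 0 ≤ π x a) (hπ1 : ∀ x, ∑ a, π x a = 1) (x' : X) :
    stateOcc γ P ν₀ π x' = (1 - γ) * ν₀ x'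
      + γ * ∑ x, ∑ a, stateOcc γ P ν₀ π x * π x a * P x a x' := by
  have hs := summable_discounted_stateDist hγ0 hγ1 hP0 hP1 hν0 hν1 hπ0 hπ1
  have hstep : ∑' t : ℕ, γ ^ (t + 1) * stateDist P ν₀ π (t + 1) x'
      = γ * ∑ x, ∑ a, (∑' t : ℕ, γ ^ t * stateDist P ν₀ π t x) * π x a * P x a x' := by
    simp only [← tsum_mul_right]
    have hsx : ∀ x a, Summable fun t : ℕ => γ ^ t * stateDist P ν₀ π t x * π x a * P x a x' :=
      fun x a => ((hs x).mul_right _).mul_right _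
    simp_rw [← Summable.tsum_finsetSum fun a _ => hsx _ a]
    rw [← Summable.tsum_finsetSum fun x _ => summable_sum fun a _ => hsx x a, ← tsum_mul_left]
    refine tsum_congr fun t => ?_
    simp only [stateDist, mul_sum]
    exact sum_congr rfl fun x _ => sum_congr rfl fun a _ => by ring
  rw [stateOcc, (hs x').tsum_eq_zero_add, hstep]
  simp only [stateOcc, stateDist, mul_sum, mul_add, pow_zero, one_mul]
  congr 1
  exact sum_congr rfl fun x _ => sum_congr rfl fun a _ => by ring

end Occupancy

section Flow

variable {X A : Type*} [Fintype X] [Fintype A]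

/-- Absolute continuity of policies on visited states passes to the solutions of the flow
equations. -/
lemma flow_absolutelyContinuous {γ : ℝ} (hγ0 : 0 < γ) (hγ1 : γ < 1) {P : X → A → X → ℝ}
    (hP0 : ∀ x a x', 0 ≤ P x a x') (hP1 : ∀ x a, ∑ x', P x a x' = 1)
    {ν₀ ν ν' : X → ℝ} (hν₀ : ∀ x, 0 ≤ ν₀ x) (hν : ∀ x, 0 ≤ ν x) (hν' : ∀ x, 0 ≤ ν' x)
    {π π' : X → A → ℝ} (hπ : ∀ x a, 0 ≤ π x a) (hπ' : ∀ x a, 0 ≤ π' x a)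
    (hπ'1 : ∀ x, ∑ a, π' x a = 1)
    (hflow : ∀ x', ν x' = (1 - γ) * ν₀ x' + γ * ∑ x, ∑ a, ν x * π x a * P x a x')
    (hflow' : ∀ x', ν' x' = (1 - γ) * ν₀ x' + γ * ∑ x, ∑ a, ν' x * π' x a * P x a x')
    (hac : ∀ x, ν' x ≠ 0 → ∀ a, π x a = 0 → π' x a = 0) (x : X) (hx : ν x = 0) : ν' x = 0 := by
  classical
  set D := univ.filter fun x => ν x = 0 with hD
  have hsource : ∀ x' ∈ D, ν₀ x' = 0 ∧ ∀ x a, ν x * π x a * P x a x' = 0 := by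
    intro x' hx'
    have hterm : ∀ x a, 0 ≤ ν x * π x a * P x a x' := fun x a =>
      mul_nonneg (mul_nonneg (hν x) (hπ x a)) (hP0 x a x')
    have hsum : 0 ≤ ∑ x, ∑ a, ν x * π x a * P x a x' :=
      sum_nonneg fun x _ => sum_nonneg fun a _ => hterm x a
    have heq := hflow x'
    rw [(mem_filter.1 hx').2] at heq
    have h₁ := mul_nonneg (sub_nonneg.2 hγ1.le) (hν₀ x')
    have h₂ := mul_nonneg hγ0.le hsum
    constructor
    · exact (mul_eq_zero.1 (by linarith : (1 - γ) * ν₀ x' = 0)).resolve_left (by linarith)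
    · intro y a
      have hzero := (mul_eq_zero.1
        (by linarith : γ * ∑ x, ∑ a, ν x * π x a * P x a x' = 0)).resolve_left hγ0.ne'
      have hy := (sum_eq_zero_iff_of_nonneg fun x _ => sum_nonneg fun a _ => hterm x a).1 hzero y
        (mem_univ y)
      exact (sum_eq_zero_iff_of_nonneg fun a _ => hterm y a).1 hy a (mem_univ a)
  have hle : ∑ x' ∈ D, ν' x' ≤ γ * ∑ x' ∈ D, ν' x' := by
    calc ∑ x' ∈ D, ν' x' = γ * ∑ x' ∈ D, ∑ x, ∑ a, ν' x * π' x a * P x a x' := by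
          rw [mul_sum]
          refine sum_congr rfl fun x' hx' => ?_
          rw [hflow' x', (hsource x' hx').1, mul_zero, zero_add]
      _ = γ * ∑ x, ∑ a, ν' x * π' x a * ∑ x' ∈ D, P x a x' := by
          rw [sum_comm]
          simp only [mul_sum]
          refine sum_congr rfl fun x _ => ?_
          rw [sum_comm]
      _ ≤ γ * ∑ x, if ν x = 0 then ν' x else 0 := by
          refine mul_le_mul_of_nonneg_left (sum_le_sum fun x _ => ?_) hγ0.le
          split_ifs with hνx
          · calc _ ≤ ∑ a, ν' x * π' x a := by
                  refine sum_le_sum fun a _ => mul_le_of_le_one_right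
                    (mul_nonneg (hν' x) (hπ' x a)) ?_
                  rw [← hP1 x a]
                  exact sum_le_sum_of_subset_of_nonneg (subset_univ _) fun y _ _ => hP0 x a y
              _ = ν' x := by rw [← mul_sum, hπ'1, mul_one]
          · refine (sum_eq_zero fun a _ => ?_).le
            by_cases hν'x : ν' x = 0
            · simp [hν'x]
            by_cases hπx : π x a = 0
            · simp [hac x hν'x a hπx]
            rw [sum_eq_zero fun x' hx' => ?_, mul_zero]
            exact (mul_eq_zero.1 ((hsource x' hx').2 x a)).resolve_left (mul_ne_zero hνx hπx)
      _ = γ * ∑ x' ∈ D, ν' x' := by rw [hD, sum_filter]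
  have hnn : 0 ≤ ∑ x' ∈ D, ν' x' := sum_nonneg fun y _ => hν' y
  have hzero : ∑ x' ∈ D, ν' x' = 0 := by nlinarith
  exact (sum_eq_zero_iff_of_nonneg fun y _ => hν' y).1 hzero x (by simp [hD, hx])

/-- One step of the flow contracts relative entropy by the discount factor. -/
lemma flow_entropy_contraction {γ : ℝ} (hγ0 : 0 < γ) (hγ1 : γ < 1) {P : X → A → X → ℝ}
    (hP0 : ∀ x a x', 0 ≤ P x a x') (hP1 : ∀ x a, ∑ x', P x a x' = 1)
    {ν₀ ν ν' : X → ℝ} (hν₀ : ∀ x, 0 ≤ ν₀ x) (hν : ∀ x, 0 ≤ ν x) (hν' : ∀ x, 0 ≤ ν' x)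
    {μ μ' : X → A → ℝ} (hμ : ∀ x a, 0 ≤ μ x a) (hμ' : ∀ x a, 0 ≤ μ' x a)
    (hflow : ∀ x', ν x' = (1 - γ) * ν₀ x' + γ * ∑ x, ∑ a, μ x a * P x a x')
    (hflow' : ∀ x', ν' x' = (1 - γ) * ν₀ x' + γ * ∑ x, ∑ a, μ' x a * P x a x')
    (hνac : ∀ x, ν x = 0 → ν' x = 0) (hμac : ∀ x a, μ x a = 0 → μ' x a = 0) :
    ∑ x, ν' x * Real.log (ν' x / ν x)
      ≤ γ * ∑ x, ∑ a, μ' x a * Real.log (μ' x a / μ x a) := by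
  have hpoint : ∀ x', ν' x' * Real.log (ν' x' / ν x')
      ≤ γ * ∑ x, ∑ a, μ' x a * Real.log (μ' x a / μ x a) * P x a x' := by
    intro x'
    have hterm : ∀ x a, 0 ≤ μ' x a * P x a x' := fun x a => mul_nonneg (hμ' x a) (hP0 x a x')
    have hsum : 0 ≤ ∑ x, ∑ a, μ' x a * P x a x' :=
      sum_nonneg fun x _ => sum_nonneg fun a _ => hterm x a
    have h₁ := mul_nonneg (sub_nonneg.2 hγ1.le) (hν₀ x')
    by_cases hx' : ν' x' = 0
    · have heq := hflow' x'
      have h₂ := mul_nonneg hγ0.le hsum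
      have hzero := (mul_eq_zero.1
        (by linarith : γ * ∑ x, ∑ a, μ' x a * P x a x' = 0)).resolve_left hγ0.ne'
      rw [hx', zero_mul, sum_eq_zero fun x _ => sum_eq_zero fun a _ => ?_, mul_zero]
      have hx := (sum_eq_zero_iff_of_nonneg fun x _ => sum_nonneg fun a _ => hterm x a).1 hzero x
        (mem_univ x)
      have hxa := (sum_eq_zero_iff_of_nonneg fun a _ => hterm x a).1 hx a (mem_univ a)
      linear_combination Real.log (μ' x a / μ x a) * hxa
    · have hν'pos : 0 < ν' x' := (hν' x').lt_of_ne' hx'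
      have hνpos : 0 < ν x' := (hν x').lt_of_ne' fun h => hx' (hνac x' h)
      set c := ν' x' / ν x' with hc
      have hcpos : 0 < c := div_pos hν'pos hνpos
      have hcν : c * ν x' = ν' x' := div_mul_cancel₀ _ hνpos.ne'
      have htangent : ∑ x, ∑ a, (μ' x a * Real.log c + μ' x a - c * μ x a) * P x a x'
          ≤ ∑ x, ∑ a, μ' x a * Real.log (μ' x a / μ x a) * P x a x' :=
        sum_le_sum fun x _ => sum_le_sum fun a _ => mul_le_mul_of_nonneg_right
          (mul_log_add_sub_le_mul_log_div (hμ' x a) (hμ x a) (hμac x a) hcpos) (hP0 x a x')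
      have hexpand : ∑ x, ∑ a, (μ' x a * Real.log c + μ' x a - c * μ x a) * P x a x'
          = (Real.log c + 1) * (∑ x, ∑ a, μ' x a * P x a x')
            - c * ∑ x, ∑ a, μ x a * P x a x' := by
        simp only [mul_sum, ← sum_sub_distrib]
        exact sum_congr rfl fun x _ => sum_congr rfl fun a _ => by ring
      rw [hexpand] at htangent
      refine le_trans ?_ (mul_le_mul_of_nonneg_left htangent hγ0.le)
      have hlog := mul_le_mul_of_nonneg_left (Real.log_le_sub_one_of_pos hcpos) h₁
      have hB := hflow x'
      have hB' := hflow' x'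
      have hid : γ * ((Real.log c + 1) * (∑ x, ∑ a, μ' x a * P x a x')
            - c * ∑ x, ∑ a, μ x a * P x a x')
          = ν' x' * Real.log c
            + ((1 - γ) * ν₀ x' * (c - 1) - (1 - γ) * ν₀ x' * Real.log c) := by
        linear_combination (-(Real.log c + 1)) * hB' + c * hB - hcν
      linarith
  calc _ ≤ ∑ x', γ * ∑ x, ∑ a, μ' x a * Real.log (μ' x a / μ x a) * P x a x' :=
        sum_le_sum fun x' _ => hpoint x'
    _ = γ * ∑ x, ∑ a, μ' x a * Real.log (μ' x a / μ x a) := by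
        rw [← mul_sum, sum_comm]
        congr 1
        refine sum_congr rfl fun x _ => ?_
        rw [sum_comm]
        simp only [← mul_sum, hP1, mul_one]

/-- The chain rule for relative entropy. -/
lemma sum_mul_log_div_chain_rule {ν ν' : X → ℝ} {π π' : X → A → ℝ}
    (hπ'1 : ∀ x, ∑ a, π' x a = 1) (hνac : ∀ x, ν x = 0 → ν' x = 0)
    (hac : ∀ x, ν' x ≠ 0 → ∀ a, π x a = 0 → π' x a = 0) :
    ∑ x, ∑ a, ν' x * π' x a * Real.log (ν' x * π' x a / (ν x * π x a))
      = ∑ x, ν' x * Real.log (ν' x / ν x)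
        + ∑ x, ν' x * ∑ a, π' x a * Real.log (π' x a / π x a) := by
  rw [← sum_add_distrib]
  refine sum_congr rfl fun x _ => ?_
  have hx : ν' x * Real.log (ν' x / ν x) = ∑ a, ν' x * π' x a * Real.log (ν' x / ν x) := by
    rw [← sum_mul, ← mul_sum, hπ'1, mul_one]
  rw [hx, mul_sum, ← sum_add_distrib]
  refine sum_congr rfl fun a _ => ?_
  by_cases hν'x : ν' x = 0
  · simp [hν'x]
  by_cases hπ'x : π' x a = 0
  · simp [hπ'x]
  have hνx : ν x ≠ 0 := fun h => hν'x (hνac x h)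
  have hπx : π x a ≠ 0 := fun h => hπ'x (hac x hν'x a h)
  rw [mul_div_mul_comm, Real.log_mul (div_ne_zero hν'x hνx) (div_ne_zero hπ'x hπx)]
  ring

end Flow

/-- Pinsker-type bound for occupancy measures: for any policies `π, π'` and `Q : X×A → [0,H]`,
`⟨μ^{π'}, Q⟩ − ⟨μ^π, Q⟩ ≤ √(2 H³ H(π'‖π))`. -/
theorem stmt_4 {X A : Type*} [Fintype X] [Fintype A] [Nonempty X] [Nonempty A]
    (γ : ℝ) (hγ0 : 0 < γ) (hγ1 : γ < 1) (H : ℝ) (hH : H = 1 / (1 - γ))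
    (P : X → A → X → ℝ) (hP0 : ∀ x a x', 0 ≤ P x a x') (hP1 : ∀ x a, ∑ x', P x a x' = 1)
    (ν₀ : X → ℝ) (hν0 : ∀ x, 0 ≤ ν₀ x) (hν1 : ∑ x, ν₀ x = 1)
    (π : X → A → ℝ) (hπ0 : ∀ x a, 0 ≤ π x a) (hπ1 : ∀ x, ∑ a, π x a = 1)
    (π' : X → A → ℝ) (hπ'0 : ∀ x a, 0 ≤ π' x a) (hπ'1 : ∀ x, ∑ a, π' x a = 1)
    (Q : X → A → ℝ) (hQ0 : ∀ x a, 0 ≤ Q x a) (hQH : ∀ x a, Q x a ≤ H) :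
    ENNReal.ofReal
        ((∑ x, ∑ a, occ γ P ν₀ π' x a * Q x a) - ∑ x, ∑ a, occ γ P ν₀ π x a * Q x a)
      ≤ (ENNReal.ofReal (2 * H ^ 3) * condKL γ P ν₀ π' π) ^ ((1 : ℝ) / 2) := by
  have hγ : 0 < 1 - γ := sub_pos.2 hγ1
  have hHpos : 0 < H := hH ▸ one_div_pos.2 hγ
  set ν := stateOcc γ P ν₀ π with hνdef
  set ν' := stateOcc γ P ν₀ π' with hν'def
  have hν : ∀ x, 0 ≤ ν x := stateOcc_nonneg hγ0 hγ1 hP0 hν0 hπ0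
  have hν' : ∀ x, 0 ≤ ν' x := stateOcc_nonneg hγ0 hγ1 hP0 hν0 hπ'0
  have hflow := stateOcc_eq hγ0 hγ1 hP0 hP1 hν0 hν1 hπ0 hπ1
  have hflow' := stateOcc_eq hγ0 hγ1 hP0 hP1 hν0 hν1 hπ'0 hπ'1
  have hcond : condKL γ P ν₀ π' π = ∑ x, ENNReal.ofReal (ν' x) * KLd (π' x) (π x) := by
    simp only [condKL, occ_eq_stateOcc_mul, ← mul_sum, hπ'1, mul_one, ← hν'def]
  by_cases hac : ∀ x, ν' x ≠ 0 → ∀ a, π x a = 0 → π' x a = 0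
  swap
  · push Not at hac
    obtain ⟨x, hx, a, ha, ha'⟩ := hac
    have hKL : KLd (π' x) (π x) = ⊤ := if_neg fun h => ha' (h a ha)
    have htop : condKL γ P ν₀ π' π = ⊤ := by
      rw [hcond, ENNReal.sum_eq_top]
      refine ⟨x, mem_univ x, ?_⟩
      rw [hKL, ENNReal.mul_top]
      simpa using (hν' x).lt_of_ne' hx
    rw [htop, ENNReal.mul_top (by simpa using pow_pos hHpos 3),
      ENNReal.top_rpow_of_pos (by norm_num)]
    exact le_top
  have hνac := flow_absolutelyContinuous hγ0 hγ1 hP0 hP1 hν0 hν hν' hπ0 hπ'0 hπ'1 hflow hflow' hac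
  have hμac : ∀ x a, ν x * π x a = 0 → ν' x * π' x a = 0 := by
    intro x a h
    by_cases hx : ν' x = 0
    · simp [hx]
    · rw [hac x hx a ((mul_eq_zero.1 h).resolve_left fun h => hx (hνac x h)), mul_zero]
  have hμ : ∀ x a, 0 ≤ ν x * π x a := fun x a => mul_nonneg (hν x) (hπ0 x a)
  have hμ' : ∀ x a, 0 ≤ ν' x * π' x a := fun x a => mul_nonneg (hν' x) (hπ'0 x a)
  set h := ∑ x, ν' x * ∑ a, π' x a * Real.log (π' x a / π x a) with hh
  set K := ∑ x, ∑ a, ν' x * π' x a * Real.log (ν' x * π' x a / (ν x * π x a)) with hK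
  have hcondh : condKL γ P ν₀ π' π = ENNReal.ofReal h := by
    rw [hcond, hh, ENNReal.ofReal_sum_of_nonneg]
    · refine sum_congr rfl fun x _ => ?_
      by_cases hx : ν' x = 0
      · simp [hx]
      · rw [KLd_of_forall (hac x hx), ENNReal.ofReal_mul (hν' x)]
    · intro x _
      by_cases hx : ν' x = 0
      · simp [hx]
      · exact mul_nonneg (hν' x) (sum_mul_log_div_nonneg (hπ'0 x) (hπ0 x) (hac x hx)
          (by rw [hπ1, hπ'1]))
  have hKh : K ≤ H * h := by
    have hcontr := flow_entropy_contraction hγ0 hγ1 hP0 hP1 hν0 hν hν' hμ hμ' hflow hflow'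
      hνac hμac
    have hchain := sum_mul_log_div_chain_rule hπ'1 hνac hac
    rw [hH, one_div, inv_mul_eq_div, le_div_iff₀ hγ]
    linarith
  have hpinsker := sq_sum_sub_mul_le_sum_mul_log_div (S := X × A)
    (p := fun z => ν' z.1 * π' z.1 z.2) (q := fun z => ν z.1 * π z.1 z.2)
    (f := fun z => Q z.1 z.2) (M := H) (fun z => hμ' z.1 z.2) (fun z => hμ z.1 z.2)
    (fun z => hμac z.1 z.2)
    (by simp only [Fintype.sum_prod_type, ← mul_sum, hπ'1, mul_one]
        exact sum_stateOcc hγ0 hγ1 hP0 hP1 hν0 hν1 hπ'0 hπ'1)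
    (by simp only [Fintype.sum_prod_type, ← mul_sum, hπ1, mul_one]
        exact sum_stateOcc hγ0 hγ1 hP0 hP1 hν0 hν1 hπ0 hπ1)
    (fun z => hQ0 z.1 z.2) (fun z => hQH z.1 z.2)
  simp only [Fintype.sum_prod_type, sub_mul, sum_sub_distrib, ← hK] at hpinsker
  have hKnn : 0 ≤ K := by
    by_contra! hlt
    nlinarith [sq_nonneg ((∑ x, ∑ a, ν' x * π' x a * Q x a) - ∑ x, ∑ a, ν x * π x a * Q x a),
      mul_pos (pow_pos hHpos 2) (neg_pos.2 hlt)]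
  have hhnn : 0 ≤ h := nonneg_of_mul_nonneg_right (hKnn.trans hKh) hHpos
  have hbound : 0 ≤ 2 * H ^ 3 * h := by positivity
  simp only [occ_eq_stateOcc_mul, ← hνdef, ← hν'def]
  rw [hcondh, ← ENNReal.ofReal_mul (by positivity),
    ENNReal.ofReal_rpow_of_nonneg hbound (by norm_num), ← Real.sqrt_eq_rpow]
  refine ENNReal.ofReal_le_ofReal (Real.le_sqrt_of_sq_le (hpinsker.trans ?_))
  calc H ^ 2 * K ≤ H ^ 2 * (H * h) := by gcongr
    _ ≤ 2 * H ^ 3 * h := by linarith
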